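/- Fix a > 0 and let X, Y be independent standard Lévy random variables. Define Z(x,y;a) = ∫₀^∞ e^{−at} t^{3/2} ((e^{−tx} + e^{−ty})/2 − e^{−t(x+y)/4}) dt for x, y > 0. Then E[Z(X,Y;a)] = 0. -/

import Mathlib

open MeasureTheory Set ProbabilityTheory

/-- The density of the Lévy distribution with scale parameter `l`, extended by `0` off `(0,∞)`. -/
noncomputable def levyPDF (l x : ℝ) : ℝ :=
  if 0 < x then Real.sqrt (l / (2 * Real.pi)) * Real.exp (-(l / (2 * x))) * x ^ (-(3:ℝ)/2) else 0

/-- The Lévy distribution with scale parameter `l`, as a measure on `ℝ`. -/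
noncomputable def levyMeasure (l : ℝ) : Measure ℝ :=
  volume.withDensity (fun x => ENNReal.ofReal (levyPDF l x))

/-- The symmetric kernel of the V-statistic `R_{n,a}`:
`Z(x,y;a) = ∫₀^∞ e^{-at} t^{3/2} ((e^{-tx} + e^{-ty})/2 - e^{-t(x+y)/4}) dt`. -/
noncomputable def levyKernelZ (a x y : ℝ) : ℝ :=
  ∫ t in Set.Ioi (0:ℝ), Real.exp (-(a * t)) * t ^ ((3:ℝ)/2) *
    ((Real.exp (-(t * x)) + Real.exp (-(t * y))) / 2 - Real.exp (-(t * (x + y) / 4)))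

/-- The substitution `u ↦ u - c / u` maps `(0, ∞)` onto the real line. -/
lemma image_sub_div_Ioi {c : ℝ} (hc : 0 < c) :
    (fun u : ℝ => u - c / u) '' Ioi 0 = univ := by
  refine eq_univ_of_forall fun v => ?_
  have hs : 0 ≤ v ^ 2 + 4 * c := by positivity
  have hlt : |v| < √(v ^ 2 + 4 * c) := by
    rw [← Real.sqrt_sq_eq_abs]
    exact Real.sqrt_lt_sqrt (sq_nonneg v) (by linarith)
  have hpos : 0 < v + √(v ^ 2 + 4 * c) := by linarith [neg_abs_le v]
  refine ⟨(v + √(v ^ 2 + 4 * c)) / 2, by simpa using hpos, ?_⟩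
  have := Real.sq_sqrt hs
  field_simp
  nlinarith

lemma injOn_sub_div_Ioi {c : ℝ} (hc : 0 < c) :
    InjOn (fun u : ℝ => u - c / u) (Ioi 0) := by
  refine StrictMonoOn.injOn fun x (hx : 0 < x) y _ hxy => ?_
  have : c / y < c / x := div_lt_div_of_pos_left hc hx hxy
  linarith

lemma hasDerivAt_sub_div (c : ℝ) {u : ℝ} (hu : u ≠ 0) :
    HasDerivAt (fun u : ℝ => u - c / u) (1 + c / u ^ 2) u := by
  have h := (hasDerivAt_id u).sub ((hasDerivAt_inv hu).const_mul c)
  refine (h.congr_deriv ?_).congr_of_eventuallyEq (.of_forall fun _ => ?_)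
  · ring
  · simp [div_eq_mul_inv]

/-- The reciprocal substitution `u ↦ c / u` on `(0, ∞)`. -/
lemma integral_comp_div_Ioi {c : ℝ} (hc : 0 < c) (f : ℝ → ℝ) :
    ∫ u in Ioi 0, c / u ^ 2 * f (c / u) = ∫ u in Ioi 0, f u := by
  have himage : (fun u : ℝ => c / u) '' Ioi 0 = Ioi 0 := by
    ext v
    refine ⟨?_, fun hv => ⟨c / v, div_pos hc hv, ?_⟩⟩
    · rintro ⟨u, hu, rfl⟩
      exact div_pos hc hu
    · have : v ≠ 0 := ne_of_gt hv
      field_simp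
  have hderiv : ∀ u ∈ Ioi (0 : ℝ),
      HasDerivWithinAt (fun u : ℝ => c / u) (-(c / u ^ 2)) (Ioi 0) u := by
    intro u hu
    have h := (hasDerivAt_inv (ne_of_gt hu)).const_mul c
    exact (h.congr_deriv (by ring)).hasDerivWithinAt
  have hinj : InjOn (fun u : ℝ => c / u) (Ioi 0) := by
    intro x hx y hy hxy
    have hx' : x ≠ 0 := ne_of_gt hx
    have hy' : y ≠ 0 := ne_of_gt hy
    field_simp at hxy
    exact hxy.symm
  have h := integral_image_eq_integral_abs_deriv_smul measurableSet_Ioi hderiv hinj f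
  rw [himage] at h
  rw [h]
  refine setIntegral_congr_fun measurableSet_Ioi fun u _ => ?_
  simp only [abs_neg, smul_eq_mul]
  rw [abs_of_nonneg (by positivity)]

/-- The Cauchy–Schlömilch substitution for integrable even functions. -/
lemma integral_even_comp_sub_div_Ioi {c : ℝ} (hc : 0 < c) {f : ℝ → ℝ} (hf : Integrable f)
    (hmeas : Measurable f) (heven : ∀ v, f (-v) = f v) :
    2 * ∫ u in Ioi 0, f (u - c / u) = ∫ v, f v := by
  have hderiv : ∀ u ∈ Ioi (0 : ℝ),
      HasDerivWithinAt (fun u : ℝ => u - c / u) (1 + c / u ^ 2) (Ioi 0) u :=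
    fun u hu => (hasDerivAt_sub_div c (ne_of_gt hu)).hasDerivWithinAt
  have habs : ∀ u : ℝ, |1 + c / u ^ 2| = 1 + c / u ^ 2 := fun u => abs_of_nonneg (by positivity)
  have hchange := integral_image_eq_integral_abs_deriv_smul measurableSet_Ioi hderiv
    (injOn_sub_div_Ioi hc) f
  have hjoint := (integrableOn_image_iff_integrableOn_abs_deriv_smul measurableSet_Ioi hderiv
    (injOn_sub_div_Ioi hc) f).1 (by rw [image_sub_div_Ioi hc]; exact hf.integrableOn)
  simp only [habs, smul_eq_mul, image_sub_div_Ioi hc, setIntegral_univ] at hchange hjoint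
  have hcomp : Measurable fun u : ℝ => f (u - c / u) := by fun_prop
  have hint_left : IntegrableOn (fun u => f (u - c / u)) (Ioi 0) := by
    refine Integrable.mono hjoint hcomp.aestronglyMeasurable (.of_forall fun u => ?_)
    rw [norm_mul, Real.norm_eq_abs (1 + c / u ^ 2), habs]
    exact le_mul_of_one_le_left (norm_nonneg _) (le_add_of_nonneg_right (by positivity))
  have hint_right : IntegrableOn (fun u => c / u ^ 2 * f (u - c / u)) (Ioi 0) := by
    refine (Integrable.sub hjoint hint_left).congr (.of_forall fun u => ?_)
    simp only [Pi.sub_apply]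
    ring
  have hreflect : ∫ u in Ioi 0, c / u ^ 2 * f (u - c / u) = ∫ u in Ioi 0, f (u - c / u) := by
    rw [← integral_comp_div_Ioi hc fun u => f (u - c / u)]
    refine setIntegral_congr_fun measurableSet_Ioi fun u hu => ?_
    have hu' : u ≠ 0 := ne_of_gt hu
    have : c / u - c / (c / u) = -(u - c / u) := by field_simp; ring
    simp only [this, heven]
  rw [hchange]
  simp only [add_mul, one_mul]
  rw [integral_add hint_left hint_right, hreflect, two_mul]

lemma integral_exp_neg_sq_add_div_sq {t : ℝ} (ht : 0 < t) :
    ∫ u in Ioi 0, Real.exp (-(u ^ 2 / 2) - t / u ^ 2) =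
      √(2 * Real.pi) / 2 * Real.exp (-√(2 * t)) := by
  have hgauss := integral_gaussian (1 / 2)
  have hmain := integral_even_comp_sub_div_Ioi (c := √(2 * t)) (by positivity)
    (integrable_exp_neg_mul_sq (b := 1 / 2) (by norm_num)) (by fun_prop) (by simp)
  rw [hgauss] at hmain
  have hpi : Real.pi / (1 / 2) = 2 * Real.pi := by ring
  rw [hpi] at hmain
  rw [← hmain, mul_div_cancel_left₀ _ two_ne_zero, mul_comm, ← integral_const_mul]
  refine setIntegral_congr_fun measurableSet_Ioi fun u hu => ?_
  have hu' : u ≠ 0 := ne_of_gt hu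
  have hsq := Real.sq_sqrt (show 0 ≤ 2 * t by positivity)
  simp only [← Real.exp_add]
  congr 1
  field_simp
  linear_combination hsq

lemma measurable_levyPDF (l : ℝ) : Measurable (levyPDF l) := by
  unfold levyPDF
  exact Measurable.ite measurableSet_Ioi (by fun_prop) measurable_const

lemma levyPDF_nonneg (l x : ℝ) : 0 ≤ levyPDF l x := by
  unfold levyPDF
  split_ifs <;> positivity

lemma ae_pos_levyMeasure (l : ℝ) : ∀ᵐ x ∂levyMeasure l, 0 < x := by
  rw [levyMeasure, ae_withDensity_iff (measurable_levyPDF l).ennreal_ofReal]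
  refine .of_forall fun x hx => ?_
  by_contra hneg
  simp [levyPDF, hneg] at hx

/-- The Laplace transform of the standard Lévy distribution. -/
lemma mgf_levyMeasure_neg {t : ℝ} (ht : 0 < t) :
    mgf id (levyMeasure 1) (-t) = Real.exp (-√(2 * t)) := by
  have hdens : mgf id (levyMeasure 1) (-t) = ∫ x, levyPDF 1 x * Real.exp (-t * x) := by
    rw [mgf, levyMeasure, integral_withDensity_eq_integral_toReal_smul
      (measurable_levyPDF 1).ennreal_ofReal (.of_forall fun _ => ENNReal.ofReal_lt_top)]
    simp [ENNReal.toReal_ofReal (levyPDF_nonneg 1 _)]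
  have hsupp : ∫ x, levyPDF 1 x * Real.exp (-t * x) =
      ∫ x in Ioi 0, levyPDF 1 x * Real.exp (-t * x) := by
    refine (setIntegral_eq_integral_of_forall_compl_eq_zero fun x hx => ?_).symm
    simp [levyPDF, show ¬ 0 < x from hx]
  have hsubst := integral_comp_rpow_Ioi (fun u : ℝ => Real.exp (-(u ^ 2 / 2) - t / u ^ 2))
    (p := -(1 / 2)) (by norm_num)
  rw [integral_exp_neg_sq_add_div_sq ht] at hsubst
  have hconst : √(1 / (2 * Real.pi)) * 2 * (√(2 * Real.pi) / 2) = 1 := by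
    rw [Real.sqrt_div zero_le_one, Real.sqrt_one]
    have : √(2 * Real.pi) ≠ 0 := by positivity
    field_simp
  calc mgf id (levyMeasure 1) (-t)
      = ∫ x in Ioi 0, levyPDF 1 x * Real.exp (-t * x) := hdens.trans hsupp
    _ = √(1 / (2 * Real.pi)) * 2 *
          ∫ x in Ioi (0 : ℝ), (|(-(1 / 2) : ℝ)| * x ^ (-(1 / 2) - 1 : ℝ)) •
            Real.exp (-((x ^ (-(1 / 2) : ℝ)) ^ 2 / 2) - t / (x ^ (-(1 / 2) : ℝ)) ^ 2) := by
        rw [← integral_const_mul]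
        refine setIntegral_congr_fun measurableSet_Ioi fun x (hx : 0 < x) => ?_
        have hsq : (x ^ (-(1 / 2) : ℝ)) ^ 2 = x⁻¹ := by
          rw [← Real.rpow_mul_natCast hx.le, ← Real.rpow_neg_one]
          norm_num
        have hexp : (-(1 / 2) - 1 : ℝ) = -3 / 2 := by norm_num
        have habs : |(-(1 / 2) : ℝ)| = 1 / 2 := by norm_num
        simp only [levyPDF, hx, if_true, hsq, hexp, habs, smul_eq_mul, sub_eq_add_neg,
          Real.exp_add]
        have h₁ : x⁻¹ / 2 = 1 / (2 * x) := by field_simp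
        have h₂ : -(t / x⁻¹) = -t * x := by field_simp
        rw [h₁, h₂]
        ring
    _ = Real.exp (-√(2 * t)) := by
        rw [hsubst, ← mul_assoc, hconst, one_mul]

lemma levyMeasure_one_ne_zero : levyMeasure 1 ≠ 0 := by
  intro h
  have := mgf_levyMeasure_neg zero_lt_one
  rw [h, mgf_zero_measure] at this
  exact (Real.exp_pos _).ne this

lemma aemeasurable_of_map_eq_levyMeasure {Ω : Type*} [MeasurableSpace Ω] {μ : Measure Ω}
    {X : Ω → ℝ} (hX : Measure.map X μ = levyMeasure 1) : AEMeasurable X μ :=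
  AEMeasurable.of_map_ne_zero (hX ▸ levyMeasure_one_ne_zero)

lemma mgf_neg_of_map_eq_levyMeasure {Ω : Type*} [MeasurableSpace Ω] {μ : Measure Ω}
    {X : Ω → ℝ} (hX : Measure.map X μ = levyMeasure 1) {t : ℝ} (ht : 0 < t) :
    mgf X μ (-t) = Real.exp (-√(2 * t)) := by
  rw [← mgf_levyMeasure_neg ht, ← hX, mgf_id_map (aemeasurable_of_map_eq_levyMeasure hX)]

lemma ae_pos_of_map_eq_levyMeasure {Ω : Type*} [MeasurableSpace Ω] {μ : Measure Ω}
    {X : Ω → ℝ} (hX : Measure.map X μ = levyMeasure 1) : ∀ᵐ ω ∂μ, 0 < X ω :=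
  ae_of_ae_map (aemeasurable_of_map_eq_levyMeasure hX) (hX ▸ ae_pos_levyMeasure 1)

lemma integrable_exp_neg_mul_of_ae_pos {Ω : Type*} [MeasurableSpace Ω] {μ : Measure Ω}
    [IsFiniteMeasure μ] {X : Ω → ℝ} (hX : AEMeasurable X μ) (hpos : ∀ᵐ ω ∂μ, 0 < X ω)
    {t : ℝ} (ht : 0 < t) : Integrable (fun ω => Real.exp (-t * X ω)) μ := by
  refine Integrable.of_bound (by fun_prop) 1 ?_
  filter_upwards [hpos] with ω hω
  rw [Real.norm_eq_abs, Real.abs_exp, Real.exp_le_one_iff]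
  nlinarith

/-- For fixed `t > 0`, the integrand of the kernel is centred. -/
lemma integral_levyKernelZ_integrand {Ω : Type*} [MeasurableSpace Ω] {μ : Measure Ω}
    [IsProbabilityMeasure μ] {X Y : Ω → ℝ} (hindep : IndepFun X Y μ)
    (hX : Measure.map X μ = levyMeasure 1) (hY : Measure.map Y μ = levyMeasure 1)
    {t : ℝ} (ht : 0 < t) :
    ∫ ω, ((Real.exp (-(t * X ω)) + Real.exp (-(t * Y ω))) / 2
      - Real.exp (-(t * (X ω + Y ω) / 4))) ∂μ = 0 := by
  have hXm := aemeasurable_of_map_eq_levyMeasure hX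
  have hYm := aemeasurable_of_map_eq_levyMeasure hY
  have hXpos := ae_pos_of_map_eq_levyMeasure hX
  have hYpos := ae_pos_of_map_eq_levyMeasure hY
  have hXYpos : ∀ᵐ ω ∂μ, 0 < (X + Y) ω := by
    filter_upwards [hXpos, hYpos] with ω h₁ h₂ using add_pos h₁ h₂
  have hXint := integrable_exp_neg_mul_of_ae_pos hXm hXpos ht
  have hYint := integrable_exp_neg_mul_of_ae_pos hYm hYpos ht
  have hXYint := integrable_exp_neg_mul_of_ae_pos (hXm.add hYm) hXYpos
    (show 0 < t / 4 by positivity)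
  have hsum : mgf (X + Y) μ (-(t / 4)) = Real.exp (-√(2 * t)) := by
    have ht4 : 0 < t / 4 := by positivity
    rw [hindep.mgf_add' hXm.aestronglyMeasurable hYm.aestronglyMeasurable,
      mgf_neg_of_map_eq_levyMeasure hX ht4, mgf_neg_of_map_eq_levyMeasure hY ht4, ← Real.exp_add]
    have hsqrt : √(2 * (t / 4)) = √(2 * t) / 2 := by
      rw [show 2 * (t / 4) = 2 * t / 2 ^ 2 by ring, Real.sqrt_div (by positivity),
        Real.sqrt_sq zero_le_two]
    rw [hsqrt]
    ring_nf
  have hrewrite : ∀ ω, (Real.exp (-(t * X ω)) + Real.exp (-(t * Y ω))) / 2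
      - Real.exp (-(t * (X ω + Y ω) / 4)) =
      (Real.exp (-t * X ω) + Real.exp (-t * Y ω)) / 2 - Real.exp (-(t / 4) * (X + Y) ω) := by
    intro ω
    simp only [Pi.add_apply]
    ring_nf
  simp only [hrewrite]
  rw [integral_sub (Integrable.div_const (f := fun ω => _ + _) (hXint.add hYint) 2) hXYint,
    integral_div, integral_add hXint hYint]
  change (mgf X μ (-t) + mgf Y μ (-t)) / 2 - mgf (X + Y) μ (-(t / 4)) = 0
  rw [hsum, mgf_neg_of_map_eq_levyMeasure hX ht, mgf_neg_of_map_eq_levyMeasure hY ht]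
  ring

lemma integrable_levyKernelZ_integrand_prod {Ω : Type*} [MeasurableSpace Ω] {μ : Measure Ω}
    [IsProbabilityMeasure μ] {X Y : Ω → ℝ} {a : ℝ} (ha : 0 < a)
    (hX : AEMeasurable X μ) (hY : AEMeasurable Y μ)
    (hXpos : ∀ᵐ ω ∂μ, 0 < X ω) (hYpos : ∀ᵐ ω ∂μ, 0 < Y ω) :
    Integrable (Function.uncurry fun (ω : Ω) (t : ℝ) => Real.exp (-(a * t)) * t ^ ((3 : ℝ) / 2) *
      ((Real.exp (-(t * X ω)) + Real.exp (-(t * Y ω))) / 2 - Real.exp (-(t * (X ω + Y ω) / 4))))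
      (μ.prod (volume.restrict (Ioi 0))) := by
  have hweight : IntegrableOn (fun t : ℝ => Real.exp (-(a * t)) * t ^ ((3 : ℝ) / 2)) (Ioi 0) := by
    have h := integrableOn_rpow_mul_exp_neg_mul_rpow (s := 3 / 2) (p := 1) (b := a)
      (by norm_num) one_pos ha
    refine h.congr_fun (fun t _ => ?_) measurableSet_Ioi
    simp [mul_comm]
  have hX' : AEMeasurable (fun p : Ω × ℝ => X p.1) (μ.prod (volume.restrict (Ioi 0))) :=
    hX.comp_quasiMeasurePreserving Measure.quasiMeasurePreserving_fst
  have hY' : AEMeasurable (fun p : Ω × ℝ => Y p.1) (μ.prod (volume.restrict (Ioi 0))) :=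
    hY.comp_quasiMeasurePreserving Measure.quasiMeasurePreserving_fst
  have hbound : ∀ᵐ p ∂μ.prod (volume.restrict (Ioi (0 : ℝ))),
      ‖(Real.exp (-(p.2 * X p.1)) + Real.exp (-(p.2 * Y p.1))) / 2
        - Real.exp (-(p.2 * (X p.1 + Y p.1) / 4))‖ ≤ 1 := by
    filter_upwards [Measure.quasiMeasurePreserving_fst.ae hXpos,
      Measure.quasiMeasurePreserving_fst.ae hYpos,
      Measure.quasiMeasurePreserving_snd.ae (ae_restrict_mem measurableSet_Ioi)]
      with p hx hy (hp : 0 < p.2)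
    have h₁ : Real.exp (-(p.2 * X p.1)) ≤ 1 := by
      rw [Real.exp_le_one_iff, neg_nonpos]; positivity
    have h₂ : Real.exp (-(p.2 * Y p.1)) ≤ 1 := by
      rw [Real.exp_le_one_iff, neg_nonpos]; positivity
    have h₃ : Real.exp (-(p.2 * (X p.1 + Y p.1) / 4)) ≤ 1 := by
      rw [Real.exp_le_one_iff, neg_nonpos]; positivity
    rw [Real.norm_eq_abs, abs_le]
    constructor <;> linarith [Real.exp_pos (-(p.2 * X p.1)), Real.exp_pos (-(p.2 * Y p.1)),
      Real.exp_pos (-(p.2 * (X p.1 + Y p.1) / 4))]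
  exact (Integrable.comp_snd hweight μ).mul_bdd (by fun_prop) hbound

/-- The kernel `Z` of the statistic `R_{n,a}` is centred under the null hypothesis: if
`X, Y` are independent standard Lévy random variables, then `E[Z(X,Y;a)] = 0`. -/
theorem R_kernel_centred {Ω : Type*} [MeasurableSpace Ω] (μ : Measure Ω)
    [IsProbabilityMeasure μ] (X Y : Ω → ℝ) (a : ℝ) (ha : 0 < a)
    (hindep : IndepFun X Y μ)
    (hX : Measure.map X μ = levyMeasure 1) (hY : Measure.map Y μ = levyMeasure 1) :
    (∫ ω, levyKernelZ a (X ω) (Y ω) ∂μ) = 0 := by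
  unfold levyKernelZ
  rw [integral_integral_swap (integrable_levyKernelZ_integrand_prod ha
    (aemeasurable_of_map_eq_levyMeasure hX) (aemeasurable_of_map_eq_levyMeasure hY)
    (ae_pos_of_map_eq_levyMeasure hX) (ae_pos_of_map_eq_levyMeasure hY))]
  refine setIntegral_eq_zero_of_forall_eq_zero fun t ht => ?_
  rw [integral_const_mul, integral_levyKernelZ_integrand hindep hX hY ht, mul_zero]
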